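/- arXiv:2604.06357 — 2 statements merged into one kernel-verified Lean document; each statement's English description precedes it below -/
import Mathlib

section
/- Let T be a tree and 𝒯 a collection of subtrees of T such that any two members of 𝒯 have a common vertex. Then there exists a vertex of T contained in every member of 𝒯. -/
namespace SimpleGraph

variable {V : Type*} {T : SimpleGraph V}

/-- On a shortest walk from `v` to `r`, every vertex other than `v` is strictly closer to `r`. -/
theorem Walk.dist_lt_of_mem_support_of_length_eq_dist {v r x : V} {s : T.Walk v r}
    (hs : s.length = T.dist v r) (hx : x ∈ s.support) (hxv : x ≠ v) :
    T.dist x r < T.dist v r := by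
  classical
  have hlen := congrArg Walk.length (s.take_spec hx)
  rw [Walk.length_append] at hlen
  have hpos : (s.takeUntil x hx).length ≠ 0 := fun h => hxv (Walk.eq_of_length_eq_zero h).symm
  have := dist_le (s.dropUntil x hx)
  omega

/-- In an acyclic graph, let `v` be the vertex of a connected subgraph `H` closest to `r`. The path from a
vertex of `H` to `r` passes through `v`, and stays in `H` as long as it is not closer to `r`
than `v`. -/
theorem IsAcyclic.mem_support_and_mem_verts_of_dist_le (hT : T.IsAcyclic) {H : T.Subgraph}
    (hH : H.Connected) {r v w : V} (hv : v ∈ H.verts)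
    (hmin : ∀ x ∈ H.verts, T.dist v r ≤ T.dist x r) (hw : w ∈ H.verts) {p : T.Walk w r}
    (hp : p.IsPath) :
    v ∈ p.support ∧ ∀ x ∈ p.support, T.dist v r ≤ T.dist x r → x ∈ H.verts := by
  obtain ⟨q, hq, hqH⟩ : ∃ q : T.Walk w v, q.IsPath ∧ ∀ x ∈ q.support, x ∈ H.verts := by
    obtain ⟨q, hq⟩ := (hH.coe.preconnected ⟨w, hw⟩ ⟨v, hv⟩).exists_isPath
    refine ⟨q.map H.hom, hq.map H.hom_injective, fun x hx => ?_⟩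
    obtain ⟨y, -, rfl⟩ := List.mem_map.mp
      ((congrArg (x ∈ ·) (Walk.support_map H.hom q)).mp hx)
    exact y.2
  obtain ⟨s, hs⟩ := Reachable.exists_walk_length_eq_dist (q.reverse.append p).reachable
  have hsp := s.isPath_of_length_eq_dist hs
  have happ : (q.append s).IsPath := by
    rw [Walk.isPath_def, Walk.support_append]
    refine List.Nodup.append hq.support_nodup hsp.support_nodup.tail ?_
    intro x hxq hxs
    have hxv : x ≠ v := by
      rintro rfl
      have := hsp.support_nodup
      rw [← Walk.cons_tail_support] at this
      exact (List.nodup_cons.mp this).1 hxs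
    have := Walk.dist_lt_of_mem_support_of_length_eq_dist hs (List.mem_of_mem_tail hxs) hxv
    exact this.not_ge (hmin x (hqH x hxq))
  obtain rfl : q.append s = p :=
    congrArg Subtype.val ((hT.subsingleton_path w r).elim ⟨_, happ⟩ ⟨p, hp⟩)
  simp only [Walk.mem_support_append_iff]
  refine ⟨Or.inr s.start_mem_support, ?_⟩
  rintro x (hx | hx) hle
  · exact hqH x hx
  · by_contra hxH
    have hxv : x ≠ v := fun h => hxH (h ▸ hv)
    exact (Walk.dist_lt_of_mem_support_of_length_eq_dist hs hx hxv).not_ge hle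

end SimpleGraph

/-- **Classical Helly theorem for trees.** If `𝒯` is a collection of subtrees of a
finite tree `T` such that any two members of `𝒯` share a vertex, then some vertex of
`T` lies in every member of `𝒯`. -/
theorem vertex_helly_for_trees {V : Type*} [Fintype V] (T : SimpleGraph V) (hT : T.IsTree)
    (𝒯 : Set T.Subgraph) (h𝒯 : ∀ T' ∈ 𝒯, T'.Connected)
    (hpair : ∀ T₁ ∈ 𝒯, ∀ T₂ ∈ 𝒯, (T₁.verts ∩ T₂.verts).Nonempty) :
    ∃ v : V, ∀ T' ∈ 𝒯, v ∈ T'.verts := by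
  obtain ⟨r⟩ := hT.connected.nonempty
  have hclosest : ∀ H ∈ 𝒯, ∃ v ∈ H.verts, ∀ x ∈ H.verts, T.dist v r ≤ T.dist x r := fun H hH =>
    Set.exists_min_image H.verts (T.dist · r) (Set.toFinite _) (h𝒯 H hH).nonempty
  obtain rfl | ⟨H₀, hH₀⟩ := 𝒯.eq_empty_or_nonempty
  · exact ⟨r, by simp⟩
  obtain ⟨v₀, hv₀, hmin₀⟩ := hclosest H₀ hH₀
  obtain ⟨v, ⟨H₁, hH₁, hv, hmin⟩, hmax⟩ := Set.exists_max_image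
    {v | ∃ H ∈ 𝒯, v ∈ H.verts ∧ ∀ x ∈ H.verts, T.dist v r ≤ T.dist x r} (T.dist · r)
    (Set.toFinite _) ⟨v₀, H₀, hH₀, hv₀, hmin₀⟩
  refine ⟨v, fun H₂ hH₂ => ?_⟩
  obtain ⟨u, hu, humin⟩ := hclosest H₂ hH₂
  obtain ⟨w, hw₁, hw₂⟩ := hpair H₁ hH₁ H₂ hH₂
  obtain ⟨p, hp⟩ := (hT.connected.preconnected w r).exists_isPath
  have hvp := (hT.isAcyclic.mem_support_and_mem_verts_of_dist_le (h𝒯 H₁ hH₁) hv hmin hw₁ hp).1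
  exact (hT.isAcyclic.mem_support_and_mem_verts_of_dist_le (h𝒯 H₂ hH₂) hu humin hw₂ hp).2 v hvp
    (hmax u ⟨H₂, hH₂, hu, humin⟩)
end

section
/- Let T be a tree with T ≠ K₁, let 𝒯 be a collection of subtrees of T, and let k ≥ 0 be an integer. Suppose that for every choice of k+1 subtrees T'₁,…,T'_{k+1} ∈ 𝒯 there exist indices i ≠ j such that (V(T'_i) ∪ N(T'_i)) ∩ V(T'_j) ≠ ∅, where N(T') denotes the set of vertices outside T' adjacent to a vertex of T'. Then there exists a set of at most k edges of T that pierces 𝒯. -/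
namespace SimpleGraph

variable {V : Type*} {G : SimpleGraph V}

/-- The vertices `x` such that every walk from `r` to `x` passes through `t`: in a tree rooted
at `r`, the descendants of `t` (including `t` itself). -/
def descendants (G : SimpleGraph V) (r t : V) : Set V :=
  {x | ∀ w : G.Walk r x, t ∈ w.support}

theorem Subgraph.Connected.exists_isPath_support_subset {H : G.Subgraph} (hH : H.Connected)
    {u v : V} (hu : u ∈ H.verts) (hv : v ∈ H.verts) :
    ∃ p : G.Walk u v, p.IsPath ∧ ∀ w ∈ p.support, w ∈ H.verts := by
  classical
  obtain ⟨p, hp⟩ := (Subgraph.connected_iff_forall_exists_walk_subgraph H).1 hH |>.2 hu hv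
  refine ⟨p.bypass, p.bypass_isPath, fun w hw => hp.1 ?_⟩
  exact (Walk.mem_verts_toSubgraph p).2 (p.support_bypass_subset_support hw)

theorem Subgraph.Connected.mem_descendants {H : G.Subgraph} (hH : H.Connected) {r t x y : V}
    (ht : t ∉ H.verts) (hx : x ∈ H.verts) (hxt : x ∈ G.descendants r t) (hy : y ∈ H.verts) :
    y ∈ G.descendants r t := by
  intro w
  obtain ⟨p, -, hp⟩ := hH.exists_isPath_support_subset hy hx
  rcases (Walk.mem_support_append_iff _ _).1 (hxt (w.append p)) with h | h
  · exact h
  · exact absurd (hp t h) ht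

theorem Walk.IsPath.append {u v w : V} {p : G.Walk u v} {q : G.Walk v w} (hp : p.IsPath)
    (hq : q.IsPath) (h : ∀ z ∈ p.support, z ∈ q.support → z = v) : (p.append q).IsPath := by
  rw [Walk.isPath_def] at hp hq ⊢
  rw [Walk.support_append]
  rw [← Walk.cons_tail_support, List.nodup_cons] at hq
  refine List.nodup_append.2 ⟨hp, hq.2, fun a ha b hb hab => ?_⟩
  subst hab
  exact hq.1 (h a ha (List.mem_of_mem_tail hb) ▸ hb)

theorem Walk.dist_lt_length_of_mem_support {r t y : V} (w : G.Walk r y) (ht : t ∈ w.support)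
    (hty : t ≠ y) : G.dist r t < w.length := by
  classical
  exact (dist_le (w.takeUntil t ht)).trans_lt (w.length_takeUntil_lt_length ht hty)

theorem Connected.dist_lt_of_mem_descendants (hG : G.Connected) {r t y : V}
    (hy : y ∈ G.descendants r t) (hty : t ≠ y) : G.dist r t < G.dist r y := by
  obtain ⟨w, hw⟩ := hG.exists_walk_length_eq_dist r y
  exact hw ▸ w.dist_lt_length_of_mem_support (hy w) hty

/-- In a rooted tree, a subtree consists of descendants of its vertex closest to the root. -/
theorem IsTree.mem_descendants_of_forall_dist_le (hG : G.IsTree) {H : G.Subgraph}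
    (hH : H.Connected) {r t x : V} (ht : t ∈ H.verts)
    (hmin : ∀ y ∈ H.verts, G.dist r t ≤ G.dist r y) (hx : x ∈ H.verts) :
    x ∈ G.descendants r t := by
  classical
  intro w
  obtain ⟨q, hq, hql⟩ := hG.connected.exists_path_of_dist r t
  obtain ⟨p, hp, hpH⟩ := hH.exists_isPath_support_subset ht hx
  have hqp : (q.append p).IsPath := by
    refine hq.append hp fun z hzq hzp => ?_
    by_contra hzt
    exact absurd (q.dist_lt_length_of_mem_support hzq hzt)
      (by rw [hql]; exact (hmin z (hpH z hzp)).not_gt)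
  have heq : w.bypass = q.append p :=
    (hG.existsUnique_path r x).unique w.bypass_isPath hqp
  apply w.support_bypass_subset_support
  rw [heq, Walk.mem_support_append_iff]
  exact Or.inl q.end_mem_support

/-- In a rooted tree, all but at most one neighbor of `t` are descendants of `t`. -/
theorem IsTree.exists_adj_forall_adj_mem_descendants (hG : G.IsTree) [Nontrivial V] (r t : V) :
    ∃ p, G.Adj t p ∧ ∀ x, G.Adj x t → x ≠ p → x ∈ G.descendants r t := by
  classical
  by_cases hrt : r = t
  · subst hrt
    obtain ⟨p, hp⟩ := hG.connected.preconnected.exists_adj_of_nontrivial r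
    exact ⟨p, hp, fun x _ _ w => w.start_mem_support⟩
  · obtain ⟨q, hq, hq'⟩ := hG.existsUnique_path r t
    refine ⟨q.penultimate, (q.adj_penultimate (Walk.not_nil_of_ne hrt)).symm,
      fun x hxt hxp w => ?_⟩
    by_contra hw
    have hpath : (w.bypass.concat hxt).IsPath :=
      w.bypass_isPath.concat (fun h => hw (w.support_bypass_subset_support h)) hxt
    apply hxp
    rw [← hq' _ hpath, Walk.penultimate_concat]

/-- The set of vertices of `H` together with the vertices outside `H` adjacent to it. -/
def Subgraph.closedNeighborhood (H : G.Subgraph) : Set V :=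
  H.verts ∪ {x | x ∉ H.verts ∧ ∃ y ∈ H.verts, G.Adj x y}

theorem Subgraph.closedNeighborhood_inter_verts_nonempty_symm {H K : G.Subgraph}
    (h : (H.closedNeighborhood ∩ K.verts).Nonempty) :
    (K.closedNeighborhood ∩ H.verts).Nonempty := by
  obtain ⟨x, hx | ⟨hx, y, hy, hxy⟩, hxK⟩ := h
  · exact ⟨x, Or.inl hxK, hx⟩
  · by_cases hyK : y ∈ K.verts
    · exact ⟨y, Or.inl hyK, hy⟩
    · exact ⟨y, Or.inr ⟨hyK, x, hxK, hxy.symm⟩, hy⟩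

/-- In a nonempty family of subtrees of a tree there are a member `H` and an edge `e` such that
`e` is incident to every member that meets the closed neighborhood of `H`. -/
theorem IsTree.exists_edge_forall_closedNeighborhood [Finite V] [Nontrivial V] (hG : G.IsTree)
    {F : Set G.Subgraph} (hF : ∀ H ∈ F, H.Connected) (hne : F.Nonempty) :
    ∃ H ∈ F, ∃ e ∈ G.edgeSet, ∀ K ∈ F, (H.closedNeighborhood ∩ K.verts).Nonempty →
      ∃ v ∈ K.verts, v ∈ e := by
  obtain ⟨r⟩ := hG.connected.nonempty
  have exists_top : ∀ H ∈ F, ∃ t ∈ H.verts, ∀ y ∈ H.verts, G.dist r t ≤ G.dist r y :=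
    fun H hH => Set.exists_min_image H.verts (G.dist r) (Set.toFinite _)
      ((Subgraph.connected_iff_forall_exists_walk_subgraph H).1 (hF H hH)).1
  obtain ⟨t, ⟨H, hH, htH, hmin⟩, hmax⟩ := Set.exists_max_image
    {t | ∃ H ∈ F, t ∈ H.verts ∧ ∀ y ∈ H.verts, G.dist r t ≤ G.dist r y} (G.dist r)
    (Set.toFinite _) (by
      obtain ⟨H, hH⟩ := hne
      obtain ⟨t, ht⟩ := exists_top H hH
      exact ⟨t, H, hH, ht⟩)
  obtain ⟨p, htp, hp⟩ := hG.exists_adj_forall_adj_mem_descendants r t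
  refine ⟨H, hH, s(t, p), htp, fun K hK ⟨x, hxH, hxK⟩ => ?_⟩
  by_contra! hcon
  have htK : t ∉ K.verts := fun h => hcon t h (Sym2.mem_mk_left t p)
  have hpK : p ∉ K.verts := fun h => hcon p h (Sym2.mem_mk_right t p)
  have hxt : x ∈ G.descendants r t := by
    rcases hxH with hx | ⟨-, y, hy, hxy⟩
    · exact hG.mem_descendants_of_forall_dist_le (hF H hH) htH hmin hx
    · by_cases hyt : y = t
      · exact hp x (hyt ▸ hxy) fun h => hpK (h ▸ hxK)
      · intro w
        have := hG.mem_descendants_of_forall_dist_le (hF H hH) htH hmin hy (w.concat hxy)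
        rw [Walk.support_concat, List.mem_append, List.mem_singleton] at this
        exact this.resolve_right (Ne.symm hyt)
  obtain ⟨u, hu, humin⟩ := exists_top K hK
  exact (hmax u ⟨K, hK, hu, humin⟩).not_gt <| hG.connected.dist_lt_of_mem_descendants
    ((hF K hK).mem_descendants htK hxK hxt hu) fun h => htK (h ▸ hu)

end SimpleGraph


/-- If `T ≠ K₁` is a tree and `𝒯` a collection of subtrees such that among any `k+1`
members `T'₁, …, T'_{k+1}` of `𝒯` there are indices `i ≠ j` with
`(V(T'_i) ∪ N(T'_i)) ∩ V(T'_j) ≠ ∅`, then `𝒯` can be pierced by at most `k` edges of `T`. -/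
theorem edge_helly_neighborhood_version {V : Type*} [Fintype V] (T : SimpleGraph V)
    (hT : T.IsTree) (h2 : 2 ≤ Fintype.card V)
    (𝒯 : Set T.Subgraph) (h𝒯 : ∀ T' ∈ 𝒯, T'.Connected) (k : ℕ)
    (h : ∀ f : Fin (k + 1) → T.Subgraph, (∀ i, f i ∈ 𝒯) →
      ∃ i j, i ≠ j ∧
        ((((f i).verts ∪ {x | x ∉ (f i).verts ∧ ∃ y ∈ (f i).verts, T.Adj x y}) ∩
          (f j).verts).Nonempty)) :
    ∃ E ⊆ T.edgeSet, E.Finite ∧ E.ncard ≤ k ∧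
      ∀ T' ∈ 𝒯, ∃ v ∈ T'.verts, ∃ e ∈ E, v ∈ e := by
  have : Nontrivial V := Fintype.one_lt_card_iff_nontrivial.1 h2
  induction k generalizing 𝒯 with
  | zero =>
    refine ⟨∅, Set.empty_subset _, Set.finite_empty, by simp, fun T' hT' => ?_⟩
    obtain ⟨i, j, hij, -⟩ := h (fun _ => T') fun _ => hT'
    exact absurd (Subsingleton.elim (α := Fin 1) i j) hij
  | succ k ih =>
    rcases 𝒯.eq_empty_or_nonempty with rfl | hne
    · exact ⟨∅, Set.empty_subset _, Set.finite_empty, by simp, by simp⟩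
    obtain ⟨H, hH, e, he, hpierce⟩ := hT.exists_edge_forall_closedNeighborhood h𝒯 hne
    obtain ⟨E, hE, hEfin, hEcard, hEpierce⟩ :=
        ih {K ∈ 𝒯 | ¬ ∃ v ∈ K.verts, v ∈ e} (fun K hK => h𝒯 K hK.1) fun f hf => by
      obtain ⟨i, j, hij, hne⟩ := h (Fin.cons H f) (Fin.cases hH fun i => (hf i).1)
      induction i using Fin.cases with
      | zero =>
        induction j using Fin.cases with
        | zero => exact absurd rfl hij
        | succ j => exact absurd (hpierce _ (hf j).1 hne) (hf j).2
      | succ i =>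
        induction j using Fin.cases with
        | zero =>
          exact absurd (hpierce _ (hf i).1
            (SimpleGraph.Subgraph.closedNeighborhood_inter_verts_nonempty_symm hne)) (hf i).2
        | succ j => exact ⟨i, j, fun h => hij (h ▸ rfl), hne⟩
    refine ⟨insert e E, Set.insert_subset he hE, hEfin.insert e,
      (Set.ncard_insert_le e E).trans (Nat.succ_le_succ hEcard), fun K hK => ?_⟩
    by_cases hKe : ∃ v ∈ K.verts, v ∈ e
    · obtain ⟨v, hv, hve⟩ := hKe
      exact ⟨v, hv, e, Set.mem_insert _ _, hve⟩
    · obtain ⟨v, hv, e', he', hve'⟩ := hEpierce K ⟨hK, hKe⟩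
      exact ⟨v, hv, e', Set.mem_insert_of_mem _ he', hve'⟩
end
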